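/- Let X be a pseudocompact Tychonoff space. Then the following are equivalent: (i) X is metrizable; (ii) X²∖Δ is (ω₁,ω)-paracompact; (iii) there exists a directed set P with calibre (ω₁,ω) such that X²∖Δ is P-paracompact. -/

import Mathlib

open Set TopologicalSpace Topology

/-- A family of sets is locally finite at a point `x`: `x` has a neighborhood meeting
only finitely many members of the family. -/
def LocallyFiniteAt {X : Type*} [TopologicalSpace X] (x : X) (C : Set (Set X)) : Prop :=
  ∃ U ∈ nhds x, {A ∈ C | (A ∩ U).Nonempty}.Finite

/-- A family of sets is locally finite in `X`. -/
def LocallyFiniteFamily {X : Type*} [TopologicalSpace X] (C : Set (Set X)) : Prop :=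
  ∀ x : X, LocallyFiniteAt x C

/-- A poset is directed: every pair of elements has an upper bound. -/
def DirectedPoset (P : Type*) [Preorder P] : Prop :=
  ∀ a b : P, ∃ c : P, a ≤ c ∧ b ≤ c

/-- A poset has calibre (ω₁,ω) if every uncountable subset contains an infinite
subset with an upper bound. -/
def CalibreOmega1Omega (P : Type*) [Preorder P] : Prop :=
  ∀ S : Set P, ¬ S.Countable → ∃ T ⊆ S, T.Infinite ∧ ∃ b : P, ∀ t ∈ T, t ≤ b

/-- A collection `C` of subsets of `X` is `P`-locally finite. -/
def PLocallyFinite (P : Type*) [Preorder P] {X : Type*} [TopologicalSpace X]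
    (C : Set (Set X)) : Prop :=
  ∃ c : P → Set (Set X), (∀ p p' : P, p ≤ p' → c p ⊆ c p') ∧
    (∀ p, LocallyFiniteFamily (c p)) ∧ (⋃ p, c p) = C

def IsOpenCover {X : Type*} [TopologicalSpace X] (U : Set (Set X)) : Prop :=
  (∀ V ∈ U, IsOpen V) ∧ ⋃₀ U = univ

def IsRefinement {X : Type*} (V U : Set (Set X)) : Prop :=
  ∀ W ∈ V, ∃ W' ∈ U, W ⊆ W'

/-- `X` is `P`-paracompact: every open cover has a `P`-locally finite open refinement. -/
def PParacompact (P : Type*) [Preorder P] (X : Type*) [TopologicalSpace X] : Prop :=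
  ∀ U : Set (Set X), IsOpenCover U →
    ∃ V : Set (Set X), IsOpenCover V ∧ IsRefinement V U ∧ PLocallyFinite P V

/-- A collection is (ω₁,ω)-locally finite: every uncountable subcollection contains
an infinite locally finite subcollection. -/
def Omega1OmegaLF {X : Type*} [TopologicalSpace X] (C : Set (Set X)) : Prop :=
  ∀ D ⊆ C, ¬ D.Countable → ∃ E ⊆ D, E.Infinite ∧ LocallyFiniteFamily E

def Omega1OmegaParacompact (X : Type*) [TopologicalSpace X] : Prop :=
  ∀ U : Set (Set X), IsOpenCover U →
    ∃ V : Set (Set X), IsOpenCover V ∧ IsRefinement V U ∧ Omega1OmegaLF V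

/-- `B` is a base for the topology of `X`. -/
def IsBase {X : Type*} [TopologicalSpace X] (B : Set (Set X)) : Prop :=
  (∀ b ∈ B, IsOpen b) ∧ ∀ U : Set X, IsOpen U → ∀ x ∈ U, ∃ b ∈ B, x ∈ b ∧ b ⊆ U

/-- `X` is `P`-metrizable: it has a `(P × ℕ)`-locally finite base. -/
def PMetrizable (P : Type*) [Preorder P] (X : Type*) [TopologicalSpace X] : Prop :=
  ∃ B : Set (Set X), IsBase B ∧ PLocallyFinite (P × ℕ) B

def Omega1OmegaMetrizable (X : Type*) [TopologicalSpace X] : Prop :=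
  ∃ B : Set (Set X), IsBase B ∧ Omega1OmegaLF B

/-- Pseudocompact: every locally finite family of nonempty open sets is finite. -/
def Pseudocompact (X : Type*) [TopologicalSpace X] : Prop :=
  ∀ C : Set (Set X), (∀ U ∈ C, IsOpen U ∧ U.Nonempty) → LocallyFiniteFamily C → C.Finite

/-- The directed set of compact subsets of `M`, ordered by inclusion. -/
abbrev KM (M : Type*) [TopologicalSpace M] : Type _ := {K : Set M // IsCompact K}

/-- `X` is 𝒦(𝓜)-paracompact: every open cover has a `𝒦(M)`-locally finite open
refinement for some separable metrizable `M`. -/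
def KMclassParacompact (X : Type*) [TopologicalSpace X] : Prop :=
  ∀ U : Set (Set X), IsOpenCover U →
    ∃ (M : Type) (_ : TopologicalSpace M), SeparableSpace M ∧ MetrizableSpace M ∧
      ∃ V : Set (Set X), IsOpenCover V ∧ IsRefinement V U ∧ PLocallyFinite (KM M) V

/-- Weakly σ-locally finite collection. -/
def WeaklySigmaLF {X : Type*} [TopologicalSpace X] (C : Set (Set X)) : Prop :=
  ∃ c : ℕ → Set (Set X), (⋃ n, c n) = C ∧
    ∀ x : X, ∀ A ∈ C, ∃ n, A ∈ c n ∧ LocallyFiniteAt x (c n)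

/-- Relatively locally finite: locally finite at every point of its union. -/
def RelLocallyFinite {X : Type*} [TopologicalSpace X] (C : Set (Set X)) : Prop :=
  ∀ x ∈ ⋃₀ C, LocallyFiniteAt x C

def SigmaRelLF {X : Type*} [TopologicalSpace X] (C : Set (Set X)) : Prop :=
  ∃ c : ℕ → Set (Set X), (⋃ n, c n) = C ∧ ∀ n, RelLocallyFinite (c n)

def SigmaRelParacompact (X : Type*) [TopologicalSpace X] : Prop :=
  ∀ U : Set (Set X), IsOpenCover U →
    ∃ V : Set (Set X), IsOpenCover V ∧ IsRefinement V U ∧ SigmaRelLF V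

/-- An open set `U` is `P`-regular. -/
def PRegular (P : Type*) [Preorder P] {X : Type*} [TopologicalSpace X] (U : Set X) : Prop :=
  ∃ V : P × ℕ → Set X, (∀ q, IsOpen (V q)) ∧ (∀ q q' : P × ℕ, q ≤ q' → V q ⊆ V q') ∧
    (⋃ q, V q) = U ∧ (⋃ q, closure (V q)) = U

def PPerfectlyNormal (P : Type*) [Preorder P] (X : Type*) [TopologicalSpace X] : Prop :=
  ∀ U : Set X, IsOpen U → PRegular P U

/-- A development for `X`. -/
def IsDevelopment {X : Type*} [TopologicalSpace X] (G : ℕ → Set (Set X)) : Prop :=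
  (∀ n, IsOpenCover (G n)) ∧
    ∀ (x : X) (U : Set X), IsOpen U → x ∈ U → ∃ n, ⋃₀ {g ∈ G n | x ∈ g} ⊆ U

/-- A Moore space is a regular Hausdorff space with a development; here we record
just the existence of a development (regularity is a separate hypothesis). -/
def HasDevelopment (X : Type*) [TopologicalSpace X] : Prop :=
  ∃ G : ℕ → Set (Set X), IsDevelopment G

/-- Countably paracompact: every countable open cover has a locally finite open refinement. -/
def CountablyParacompact (X : Type*) [TopologicalSpace X] : Prop :=
  ∀ U : Set (Set X), IsOpenCover U → U.Countable →
    ∃ V : Set (Set X), IsOpenCover V ∧ IsRefinement V U ∧ LocallyFiniteFamily V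

/-- ccc: every pairwise disjoint family of nonempty open sets is countable. -/
def CCC (X : Type*) [TopologicalSpace X] : Prop :=
  ∀ C : Set (Set X), (∀ U ∈ C, IsOpen U ∧ U.Nonempty) → C.Pairwise Disjoint → C.Countable

/-- Cofinal subset of a preorder. -/
def CofinalSet {P : Type*} [Preorder P] (C : Set P) : Prop :=
  ∀ p : P, ∃ c ∈ C, p ≤ c

/-- `Q` is a Tukey quotient of `P`. -/
def TukeyQuotient (P : Type*) [Preorder P] (Q : Type*) [Preorder Q] : Prop :=
  ∃ φ : P → Q, ∀ C : Set P, CofinalSet C → CofinalSet (φ '' C)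

/-- Off-diagonal version of (ω₁,ω)-local finiteness for families of subsets of `X × X`. -/
def OffLF {X : Type*} [TopologicalSpace X] (C : Set (Set (X × X))) : Prop :=
  ∀ D ⊆ C, ¬ D.Countable → ∃ E ⊆ D, E.Infinite ∧
    ∀ p : X × X, p.1 ≠ p.2 → LocallyFiniteAt p E

lemma transfer_cover {X : Type*} [TopologicalSpace X] [T2Space X]
    (H : Omega1OmegaParacompact {p : X × X // p.1 ≠ p.2})
    (U : Set (Set (X × X))) (hU : ∀ u ∈ U, IsOpen u)
    (hcov : ∀ p : X × X, p.1 ≠ p.2 → ∃ u ∈ U, p ∈ u) :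
    ∃ V : Set (Set (X × X)), (∀ v ∈ V, IsOpen v) ∧ (∀ v ∈ V, ∀ p ∈ v, p.1 ≠ p.2) ∧
      (∀ p : X × X, p.1 ≠ p.2 → ∃ v ∈ V, p ∈ v) ∧ (∀ v ∈ V, ∃ u ∈ U, v ⊆ u) ∧ OffLF V := by
  have hop : IsOpen {p : X × X | p.1 ≠ p.2} := isOpen_ne_fun continuous_fst continuous_snd
  have hemb : IsOpenEmbedding (Subtype.val : {p : X × X // p.1 ≠ p.2} → X × X) :=
    hop.isOpenEmbedding_subtypeVal
  obtain ⟨V, ⟨hVo, hVc⟩, hVr, hVl⟩ := H ((fun u => Subtype.val ⁻¹' u) '' U) (by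
    refine ⟨?_, ?_⟩
    · rintro _ ⟨u, hu, rfl⟩
      exact (hU u hu).preimage continuous_subtype_val
    · refine eq_univ_of_forall fun p => ?_
      obtain ⟨u, hu, hpu⟩ := hcov p.1 p.2
      exact ⟨_, ⟨u, hu, rfl⟩, hpu⟩)
  have hinj : Function.Injective
      (fun v : Set {p : X × X // p.1 ≠ p.2} => (Subtype.val '' v : Set (X × X))) :=
    Subtype.val_injective.image_injective
  refine ⟨(fun v => Subtype.val '' v) '' V, ?_, ?_, ?_, ?_, ?_⟩
  · rintro _ ⟨v, hv, rfl⟩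
    exact hemb.isOpenMap _ (hVo v hv)
  · rintro _ ⟨v, hv, rfl⟩ _ ⟨p, hp, rfl⟩
    exact p.2
  · intro p hp
    have : (⟨p, hp⟩ : {p : X × X // p.1 ≠ p.2}) ∈ ⋃₀ V := by rw [hVc]; trivial
    obtain ⟨v, hv, hpv⟩ := this
    exact ⟨_, ⟨v, hv, rfl⟩, ⟨_, hpv, rfl⟩⟩
  · rintro _ ⟨v, hv, rfl⟩
    obtain ⟨_, ⟨u, hu, rfl⟩, hvu⟩ := hVr v hv
    refine ⟨u, hu, ?_⟩
    rintro _ ⟨p, hp, rfl⟩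
    exact hvu hp
  · intro D hD hDc
    obtain ⟨D', hD', rfl⟩ := subset_image_iff.1 hD
    obtain ⟨E, hE, hEi, hEl⟩ := hVl D' hD' (fun h => hDc (h.image _))
    refine ⟨(fun v => Subtype.val '' v) '' E, image_mono hE, hEi.image hinj.injOn, ?_⟩
    intro p hp
    obtain ⟨N, hN, hf⟩ := hEl ⟨p, hp⟩
    refine ⟨Subtype.val '' N, hemb.isOpenMap.image_mem_nhds hN, ?_⟩
    refine (hf.image (fun v => (Subtype.val '' v : Set (X × X)))).subset ?_
    rintro _ ⟨⟨v, hv, rfl⟩, ⟨q, ⟨q1, hq1, rfl⟩, ⟨q2, hq2, hq⟩⟩⟩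
    obtain rfl := Subtype.val_injective hq
    exact ⟨v, ⟨hv, ⟨_, hq1, hq2⟩⟩, rfl⟩

lemma pc_indexed {X : Type*} [TopologicalSpace X] (hpc : Pseudocompact X) {ι : Type*}
    (E : Set ι) (hE : E.Infinite) (f : ι → Set X) (ho : ∀ i ∈ E, IsOpen (f i))
    (hne : ∀ i ∈ E, (f i).Nonempty) :
    ∃ x, ∀ U ∈ 𝓝 x, {i ∈ E | (f i ∩ U).Nonempty}.Infinite := by
  by_contra hcon
  have hcon' : ∀ x, ∃ U ∈ 𝓝 x, {i ∈ E | (f i ∩ U).Nonempty}.Finite := by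
    intro x
    by_contra h
    exact hcon ⟨x, fun U hU hf => h ⟨U, hU, hf⟩⟩
  have hfin : (f '' E).Finite := by
    apply hpc
    · rintro _ ⟨i, hi, rfl⟩
      exact ⟨ho i hi, hne i hi⟩
    · intro x
      obtain ⟨U, hU, hf⟩ := hcon' x
      refine ⟨U, hU, (hf.image f).subset ?_⟩
      rintro _ ⟨⟨i, hi, rfl⟩, h⟩
      exact ⟨i, ⟨hi, h⟩, rfl⟩
  refine hE ((hfin.biUnion (t := fun A => {i ∈ E | f i = A}) ?_).subset ?_)
  · rintro _ ⟨i, hi, rfl⟩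
    obtain ⟨x, hx⟩ := hne i hi
    obtain ⟨U, hU, hf⟩ := hcon' x
    refine hf.subset ?_
    rintro j ⟨hj, hji⟩
    exact ⟨hj, x, hji ▸ hx, mem_of_mem_nhds hU⟩
  · intro i hi
    exact mem_biUnion (mem_image_of_mem f hi) ⟨hi, rfl⟩

lemma slice_countable {X : Type*} [TopologicalSpace X] (hpc : Pseudocompact X)
    {V : Set (Set (X × X))} (hVo : ∀ v ∈ V, IsOpen v) (hV : OffLF V)
    {a : X} {O : Set X} (hO : IsOpen O) (ha : a ∉ closure O) :
    {v ∈ V | ∃ y ∈ closure O, (a, y) ∈ v}.Countable := by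
  by_contra hc
  obtain ⟨E, hED, hEi, hEl⟩ := hV _ (fun v hv => hv.1) hc
  have hcont : Continuous (fun y : X => (a, y)) := by fun_prop
  obtain ⟨x, hx⟩ := pc_indexed hpc E hEi (fun v => (fun y => (a, y)) ⁻¹' v ∩ O)
    (fun v hv => ((hVo v (hED hv).1).preimage hcont).inter hO) (by
      intro v hv
      obtain ⟨y, hy, hyv⟩ := (hED hv).2
      exact mem_closure_iff.1 hy _ ((hVo v (hED hv).1).preimage hcont) hyv)
  by_cases hxO : x ∈ closure O
  · have hax : a ≠ x := fun h => ha (h ▸ hxO)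
    obtain ⟨N, hN, hf⟩ := hEl (a, x) hax
    refine hx _ (hcont.continuousAt.preimage_mem_nhds hN) (hf.subset ?_)
    rintro v ⟨hv, y, ⟨hy1, hy2⟩, hy3⟩
    exact ⟨hv, _, hy1, hy3⟩
  · refine hx _ (isClosed_closure.isOpen_compl.mem_nhds hxO) ?_
    convert finite_empty
    ext v
    simp only [mem_setOf_eq, mem_empty_iff_false, iff_false]
    rintro ⟨hv, y, ⟨hy1, hy2⟩, hy3⟩
    exact hy3 (subset_closure hy2)

lemma compact_closure {X : Type*} [TopologicalSpace X] [T3Space X] (hpc : Pseudocompact X)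
    (H : Omega1OmegaParacompact {p : X × X // p.1 ≠ p.2})
    {a : X} {O : Set X} (hO : IsOpen O) (ha : a ∉ closure O) : IsCompact (closure O) := by
  classical
  apply isCompact_of_finite_subcover
  intro ι U hUo hUc
  have hreg : ∀ (x : X) (W : Set X), IsOpen W → x ∈ W →
      ∃ G : Set X, IsOpen G ∧ x ∈ G ∧ closure G ⊆ W := by
    intro x W hW hx
    obtain ⟨t, ht, htc, htW⟩ := exists_mem_nhds_isClosed_subset (hW.mem_nhds hx)
    exact ⟨interior t, isOpen_interior, mem_interior_iff_mem_nhds.2 ht,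
      (closure_minimal interior_subset htc).trans htW⟩
  have hpick : ∀ x : X, ∃ (i : Option ι) (G2 G1 : Set X), x ∈ closure O →
      (∃ j, i = some j ∧ closure G2 ⊆ U j) ∧ IsOpen G2 ∧ IsOpen G1 ∧ x ∈ G1 ∧
        closure G1 ⊆ G2 := by
    intro x
    by_cases hx : x ∈ closure O
    · obtain ⟨i, hi⟩ := mem_iUnion.1 (hUc hx)
      obtain ⟨G2, h2o, h2x, h2⟩ := hreg x _ (hUo i) hi
      obtain ⟨G1, h1o, h1x, h1⟩ := hreg x _ h2o h2x
      exact ⟨some i, G2, G1, fun _ => ⟨⟨i, rfl, h2⟩, h2o, h1o, h1x, h1⟩⟩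
    · exact ⟨none, ∅, ∅, fun h => absurd h hx⟩
  choose i G2 G1 hG using hpick
  obtain ⟨V, hVo, hVd, hVc, hVr, hVl⟩ := transfer_cover H
    (((fun x => (univ : Set X) ×ˢ G1 x) '' closure O) ∪ {(univ : Set X) ×ˢ (closure O)ᶜ}) (by
      rintro u (⟨x, hx, rfl⟩ | rfl)
      · exact isOpen_univ.prod (hG x hx).2.2.1
      · exact isOpen_univ.prod isClosed_closure.isOpen_compl) (by
      rintro ⟨x, y⟩ hxy
      by_cases hy : y ∈ closure O
      · exact ⟨_, Or.inl ⟨y, hy, rfl⟩, trivial, (hG y hy).2.2.2.1⟩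
      · exact ⟨_, Or.inr rfl, trivial, hy⟩)
  have hcount := slice_countable hpc hVo hVl hO ha
  have hg : ∀ v, ∃ x, v ∈ {v ∈ V | ∃ y ∈ closure O, (a, y) ∈ v} →
      x ∈ closure O ∧ v ⊆ univ ×ˢ G1 x := by
    intro v
    by_cases hv : v ∈ {v ∈ V | ∃ y ∈ closure O, (a, y) ∈ v}
    · obtain ⟨hvV, y, hy, hyv⟩ := hv
      obtain ⟨u, (⟨x, hx, rfl⟩ | rfl), hvu⟩ := hVr v hvV
      · exact ⟨x, fun _ => ⟨hx, hvu⟩⟩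
      · exact absurd hy (hvu hyv).2
    · exact ⟨a, fun h => absurd h hv⟩
  choose g hg using hg
  set T : Set X := g '' {v ∈ V | ∃ y ∈ closure O, (a, y) ∈ v} with hT
  have hTc : T.Countable := hcount.image g
  have hTO : T ⊆ closure O := by
    rintro _ ⟨v, hv, rfl⟩
    exact (hg v hv).1
  have hTcov : ∀ y ∈ closure O, ∃ x ∈ T, y ∈ G1 x := by
    intro y hy
    have hay : a ≠ y := fun h => ha (h ▸ hy)
    obtain ⟨v, hv, hyv⟩ := hVc (a, y) hay
    have hv' : v ∈ {v ∈ V | ∃ y ∈ closure O, (a, y) ∈ v} := ⟨hv, y, hy, hyv⟩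
    exact ⟨g v, ⟨v, hv', rfl⟩, ((hg v hv').2 hyv).2⟩
  rcases T.eq_empty_or_nonempty with hTe | hTn
  · refine ⟨∅, ?_⟩
    intro y hy
    obtain ⟨x, hx, _⟩ := hTcov y hy
    simp [hTe] at hx
  obtain ⟨f, hf⟩ := hTc.exists_eq_range hTn
  have hfO : ∀ n, f n ∈ closure O := fun n => hTO (hf ▸ mem_range_self n)
  have hfcov : ∀ y ∈ closure O, ∃ n, y ∈ G1 (f n) := by
    intro y hy
    obtain ⟨x, hx, hyx⟩ := hTcov y hy
    rw [hf] at hx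
    obtain ⟨n, rfl⟩ := hx
    exact ⟨n, hyx⟩
  let K : ℕ → Set X := fun n => (G2 (f n) \ ⋃ k ∈ Iio n, closure (G1 (f k))) ∩ O
  have hKo : ∀ n, IsOpen (K n) := by
    intro n
    refine IsOpen.inter (IsOpen.sdiff (hG _ (hfO n)).2.1 ?_) hO
    exact (finite_Iio n).isClosed_biUnion fun k _ => isClosed_closure
  have hfin : {n | (K n).Nonempty}.Finite := by
    by_contra hinf
    obtain ⟨x, hx⟩ := pc_indexed hpc {n | (K n).Nonempty} hinf K (fun n _ => hKo n)
      (fun n hn => hn)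
    by_cases hxO : x ∈ closure O
    · obtain ⟨k, hk⟩ := hfcov x hxO
      refine hx _ ((hG _ (hfO k)).2.2.1.mem_nhds hk) ((finite_Iic k).subset ?_)
      rintro n ⟨hn, y, hy1, hy2⟩
      by_contra hnk
      exact hy1.1.2 (mem_biUnion (show k ∈ Iio n from mem_Iio.2 (lt_of_not_ge hnk)) (subset_closure hy2))
    · refine hx _ (isClosed_closure.isOpen_compl.mem_nhds hxO) ?_
      convert finite_empty
      ext v
      simp only [mem_setOf_eq, mem_empty_iff_false, iff_false]
      rintro ⟨hv, y, hy1, hy3⟩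
      exact hy3 (subset_closure hy1.2)
  have hOsub : O ⊆ ⋃ n ∈ {n | (K n).Nonempty}, G2 (f n) := by
    intro y hy
    have hex : ∃ n, y ∈ G2 (f n) := by
      obtain ⟨n, hn⟩ := hfcov y (subset_closure hy)
      exact ⟨n, (hG _ (hfO n)).2.2.2.2 (subset_closure hn)⟩
    have hyK : y ∈ K (Nat.find hex) := by
      refine ⟨⟨Nat.find_spec hex, ?_⟩, hy⟩
      simp only [mem_iUnion, not_exists]
      intro k hk hyk
      exact Nat.find_min hex hk ((hG _ (hfO k)).2.2.2.2 hyk)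
    exact mem_biUnion (show Nat.find hex ∈ {n | (K n).Nonempty} from ⟨y, hyK⟩)
      (Nat.find_spec hex)
  have hclsub : closure O ⊆ ⋃ n ∈ {n | (K n).Nonempty}, closure (G2 (f n)) := by
    refine closure_minimal (hOsub.trans ?_) (hfin.isClosed_biUnion fun _ _ => isClosed_closure)
    exact iUnion₂_mono fun n _ => subset_closure
  choose j hj using fun n => (hG _ (hfO n)).1
  refine ⟨hfin.toFinset.image j, ?_⟩
  intro y hy
  obtain ⟨n, hn, hyn⟩ := mem_iUnion₂.1 (hclsub hy)
  refine mem_iUnion₂.2 ⟨j n, ?_, (hj n).2 hyn⟩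
  exact Finset.mem_image_of_mem _ (hfin.mem_toFinset.2 hn)

lemma compact_of_H {X : Type*} [TopologicalSpace X] [T3Space X] (hpc : Pseudocompact X)
    (H : Omega1OmegaParacompact {p : X × X // p.1 ≠ p.2}) : CompactSpace X := by
  rcases subsingleton_or_nontrivial X with hs | hn
  · exact Finite.compactSpace
  obtain ⟨a, b, hab⟩ := exists_pair_ne X
  obtain ⟨u, hau, huo, v, hbv, hvo, huv⟩ := exists_open_nhds_disjoint_closure hab
  have ha : a ∉ closure v := fun h => huv.le_bot ⟨subset_closure hau, h⟩
  have hb : b ∉ closure (closure v)ᶜ := by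
    intro h
    obtain ⟨y, hy1, hy2⟩ := mem_closure_iff.1 h v hvo hbv
    exact hy2 (subset_closure hy1)
  have h1 := compact_closure hpc H hvo ha
  have h2 := compact_closure hpc H isClosed_closure.isOpen_compl hb
  refine ⟨(h1.union h2).of_isClosed_subset isClosed_univ ?_⟩
  intro x _
  by_cases hx : x ∈ closure v
  · exact Or.inl hx
  · exact Or.inr (subset_closure hx)

lemma point_countable {X : Type*} [TopologicalSpace X] {V : Set (Set (X × X))}
    (hV : OffLF V) (p : X × X) (hp : p.1 ≠ p.2) : {v ∈ V | p ∈ v}.Countable := by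
  by_contra hc
  obtain ⟨E, hED, hEi, hEl⟩ := hV _ (fun v hv => hv.1) hc
  obtain ⟨N, hN, hf⟩ := hEl p hp
  refine hEi (hf.subset fun v hv => ⟨hv, p, (hED hv).2, mem_of_mem_nhds hN⟩)

lemma slice_all {X : Type*} [TopologicalSpace X] [CompactSpace X] [T2Space X]
    (hpc : Pseudocompact X) {V : Set (Set (X × X))} (hVo : ∀ v ∈ V, IsOpen v)
    (hVd : ∀ v ∈ V, ∀ p ∈ v, p.1 ≠ p.2)
    (hVc : ∀ p : X × X, p.1 ≠ p.2 → ∃ v ∈ V, p ∈ v) (hV : OffLF V)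
    (A B : Set (X × X) → Set X) (hB : ∀ v ∈ V, IsOpen (B v))
    (hdis : ∀ v ∈ V, Disjoint (closure (A v)) (closure (B v)))
    (hsub : ∀ v ∈ V, v ⊆ A v ×ˢ B v) (c : X) :
    {v ∈ V | ∃ y, (c, y) ∈ v}.Countable := by
  classical
  let R : X → X → Prop := fun s t => ¬ ∃ v ∈ V, (c, s) ∈ v ∧ (c, t) ∈ v
  obtain ⟨S, hS⟩ := zorn_subset {S : Set X | c ∉ S ∧ S.Pairwise R} (by
    intro C hC hchain
    refine ⟨⋃₀ C, ⟨?_, ?_⟩, fun s hs => subset_sUnion_of_mem hs⟩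
    · rintro ⟨s, hs, hcs⟩
      exact (hC hs).1 hcs
    · exact (pairwise_sUnion hchain.directedOn).2 fun s hs => (hC hs).2)
  have hcS : c ∉ S := hS.prop.1
  have hSp : S.Pairwise R := hS.prop.2
  have fact1 : ∀ y, y ≠ c → ∃ s ∈ S, ∃ v ∈ V, (c, s) ∈ v ∧ (c, y) ∈ v := by
    intro y hy
    by_contra hcon
    have hyS : y ∉ S := by
      intro hyS
      obtain ⟨v, hv, hyv⟩ := hVc (c, y) hy.symm
      exact hcon ⟨y, hyS, v, hv, hyv, hyv⟩
    have hins : insert y S ∈ {S : Set X | c ∉ S ∧ S.Pairwise R} := by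
      refine ⟨?_, ?_⟩
      · rintro (h | h)
        · exact hy h.symm
        · exact hcS h
      · refine hSp.insert fun s hs _ => ⟨?_, ?_⟩
        · rintro ⟨v, hv, h1, h2⟩
          exact hcon ⟨s, hs, v, hv, h2, h1⟩
        · rintro ⟨v, hv, h1, h2⟩
          exact hcon ⟨s, hs, v, hv, h1, h2⟩
    exact hyS (hS.le_of_ge hins (subset_insert y S) (mem_insert y S))
  have fact2 : ∀ N ∈ 𝓝 c, (S \ N).Finite := by
    intro N hN
    have hK : IsCompact (interior N)ᶜ := isOpen_interior.isClosed_compl.isCompact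
    have hcN : c ∈ interior N := mem_interior_iff_mem_nhds.2 hN
    have hW : ∀ y, ∃ W : Set X, y ∈ (interior N)ᶜ → W ∈ 𝓝 y ∧ (S ∩ W).Subsingleton := by
      intro y
      by_cases hy : y ∈ (interior N)ᶜ
      · have hcy : c ≠ y := fun h => hy (h ▸ hcN)
        obtain ⟨v, hv, hyv⟩ := hVc (c, y) hcy
        refine ⟨(fun y => (c, y)) ⁻¹' v, fun _ => ⟨?_, ?_⟩⟩
        · exact ((hVo v hv).preimage (by fun_prop)).mem_nhds hyv
        · rintro s ⟨hs, hsv⟩ t ⟨ht, htv⟩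
          by_contra hst
          exact hSp hs ht hst ⟨v, hv, hsv, htv⟩
      · exact ⟨∅, fun h => absurd h hy⟩
    choose W hW using hW
    obtain ⟨t, ht, htc⟩ := hK.elim_nhds_subcover W fun y hy => (hW y hy).1
    refine (t.finite_toSet.biUnion (t := fun y => S ∩ W y) fun y hy =>
      (hW y (ht y hy)).2.finite).subset ?_
    rintro s ⟨hs, hsN⟩
    obtain ⟨y, hy, hsy⟩ := mem_iUnion₂.1 (htc (fun h => hsN (interior_subset h) :
      s ∈ (interior N)ᶜ))
    exact mem_biUnion (Finset.mem_coe.2 hy) ⟨hs, hsy⟩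
  by_cases hScount : S.Countable
  · have hT : {v ∈ V | ∃ s ∈ S, (c, s) ∈ v}.Countable := by
      refine (hScount.biUnion (t := fun s _ => {v ∈ V | (c, s) ∈ v}) ?_).mono ?_
      · intro s hs
        exact point_countable hV (c, s) (fun h : c = s => hcS (h ▸ hs))
      · rintro v ⟨hv, s, hs, hsv⟩
        exact mem_biUnion hs ⟨hv, hsv⟩
    refine (hT.biUnion (t := fun v' _ => {v ∈ V | ∃ y ∈ closure (B v'), (c, y) ∈ v}) ?_).mono ?_
    · rintro v' ⟨hv', s, hs, hsv⟩
      refine slice_countable hpc hVo hV (hB v' hv') fun h => ?_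
      exact (hdis v' hv').le_bot ⟨subset_closure (hsub v' hv' hsv).1, h⟩
    · rintro v ⟨hv, y, hyv⟩
      obtain ⟨s, hs, v', hv', hsv', hyv'⟩ := fact1 y (hVd v hv _ hyv).symm
      exact mem_biUnion (show v' ∈ {v ∈ V | ∃ s ∈ S, (c, s) ∈ v} from ⟨hv', s, hs, hsv'⟩)
        ⟨hv, y, subset_closure (hsub v' hv' hyv').2, hyv⟩
  · exfalso
    have hv : ∀ s, ∃ v, s ∈ S → v ∈ V ∧ (s, c) ∈ v := by
      intro s
      by_cases hs : s ∈ S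
      · obtain ⟨v, hv, h⟩ := hVc (s, c) (fun h : s = c => hcS (h ▸ hs))
        exact ⟨v, fun _ => ⟨hv, h⟩⟩
      · exact ⟨∅, fun h => absurd h hs⟩
    choose w hw using hv
    have hunc : ¬ (w '' S).Countable := by
      intro hc
      refine hScount ((hc.biUnion (t := fun v _ => {s ∈ S | w s = v}) ?_).mono ?_)
      · rintro _ ⟨s, hs, rfl⟩
        have hcA : c ∉ closure (A (w s)) := fun h =>
          (hdis _ (hw s hs).1).le_bot ⟨h, subset_closure (hsub _ (hw s hs).1 (hw s hs).2).2⟩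
        refine ((fact2 _ (isClosed_closure.isOpen_compl.mem_nhds hcA)).subset ?_).countable
        rintro t ⟨ht, hts⟩
        refine ⟨ht, fun h => h ?_⟩
        rw [← hts]
        exact subset_closure (hsub _ (hw t ht).1 (hw t ht).2).1
      · intro s hs
        exact mem_biUnion (mem_image_of_mem w hs) ⟨hs, rfl⟩
    obtain ⟨E, hEw, hEi, hEl⟩ := hV (w '' S) (by
      rintro _ ⟨s, hs, rfl⟩
      exact (hw s hs).1) hunc
    have e := hEi.natEmbedding
    have hs : ∀ n, ∃ s ∈ S, w s = (e n : Set (X × X)) := fun n => hEw (e n).2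
    choose s hsS hsw using hs
    have hsinj : Function.Injective s := by
      intro m n hmn
      apply e.injective
      apply Subtype.val_injective
      rw [← hsw, ← hsw, hmn]
    have hF : ∀ n, (S \ ((fun t => (s n, t)) ⁻¹' (w (s n)))).Finite := by
      intro n
      apply fact2
      exact ((hVo _ (hw _ (hsS n)).1).preimage (by fun_prop)).mem_nhds (hw _ (hsS n)).2
    have hFc : (⋃ n, (S \ ((fun t => (s n, t)) ⁻¹' (w (s n))))).Countable :=
      countable_iUnion fun n => (hF n).countable
    obtain ⟨t, htS, htF⟩ : ∃ t ∈ S, t ∉ ⋃ n, (S \ ((fun t => (s n, t)) ⁻¹' (w (s n)))) := by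
      by_contra hcon
      push Not at hcon
      exact hScount (hFc.mono hcon)
    have ht : ∀ n, (s n, t) ∈ w (s n) := by
      intro n
      by_contra h
      exact htF (mem_iUnion.2 ⟨n, htS, h⟩)
    obtain ⟨N, hN, hf⟩ := hEl (c, t) (fun h : c = t => hcS (h ▸ htS))
    have hN1 : (fun x => (x, t)) ⁻¹' N ∈ 𝓝 c :=
      (show Continuous (fun x : X => (x, t)) by fun_prop).continuousAt.preimage_mem_nhds hN
    have hbad : {n | s n ∉ (fun x => (x, t)) ⁻¹' N}.Finite := by
      refine ((fact2 _ hN1).preimage hsinj.injOn).subset ?_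
      intro n hn
      exact ⟨hsS n, hn⟩
    have hgood : {n | s n ∈ (fun x => (x, t)) ⁻¹' N}.Infinite := by
      have := hbad.infinite_compl
      refine this.mono ?_
      intro n hn
      by_contra h
      exact hn h
    have hinj : Function.Injective (fun n => (e n : Set (X × X))) :=
      Subtype.val_injective.comp e.injective
    refine (hgood.image hinj.injOn) (hf.subset ?_)
    rintro _ ⟨n, hn, rfl⟩
    refine ⟨(e n).2, (s n, t), ?_, hn⟩
    have := ht n
    rwa [hsw] at this

lemma exists_closing {X ι : Type*} (N : X → Set ι) (hN : ∀ x, (N x).Countable)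
    (pick : Finset ι → X) :
    ∃ C : Set X, C.Countable ∧ ∀ F : Finset ι, (∀ i ∈ F, ∃ c ∈ C, i ∈ N c) → pick F ∈ C := by
  classical
  let step : Set X → Set X := fun C =>
    C ∪ pick '' {F : Finset ι | (F : Set ι) ⊆ ⋃ c ∈ C, N c}
  let Cn : ℕ → Set X := fun n => step^[n] ∅
  have hsucc : ∀ n, Cn (n + 1) = step (Cn n) := fun n => Function.iterate_succ_apply' step n ∅
  have hmono : Monotone Cn := by
    refine monotone_nat_of_le_succ fun n => ?_
    rw [hsucc]
    exact subset_union_left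
  have hcount : ∀ n, (Cn n).Countable := by
    intro n
    induction n with
    | zero => exact countable_empty
    | succ n ih =>
      rw [hsucc]
      refine ih.union (Countable.image ?_ _)
      refine ((countable_setOf_finite_subset (ih.biUnion fun c _ => hN c)).preimage
        (f := fun F : Finset ι => (F : Set ι)) Finset.coe_injective).mono ?_
      intro F hF
      exact ⟨F.finite_toSet, hF⟩
  refine ⟨⋃ n, Cn n, countable_iUnion hcount, ?_⟩
  intro F hF
  have : ∃ n, ∀ i ∈ F, ∃ c ∈ Cn n, i ∈ N c := by
    induction F using Finset.induction_on with
    | empty => exact ⟨0, by simp⟩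
    | insert a F ha ih =>
      obtain ⟨n, hn⟩ := ih fun i hi => hF i (Finset.mem_insert_of_mem hi)
      obtain ⟨c, hc, hac⟩ := hF a (Finset.mem_insert_self a F)
      obtain ⟨m, hm⟩ := mem_iUnion.1 hc
      refine ⟨max n m, fun i hi => ?_⟩
      rcases Finset.mem_insert.1 hi with rfl | hi
      · exact ⟨c, hmono (le_max_right n m) hm, hac⟩
      · obtain ⟨d, hd, hid⟩ := hn i hi
        exact ⟨d, hmono (le_max_left n m) hd, hid⟩
  obtain ⟨n, hn⟩ := this
  refine mem_iUnion.2 ⟨n + 1, ?_⟩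
  rw [hsucc]
  refine Or.inr ⟨F, ?_, rfl⟩
  intro i hi
  obtain ⟨c, hc, hic⟩ := hn i hi
  exact mem_biUnion hc hic

lemma metrizable_of_pairs {X : Type*} [t : TopologicalSpace X] [CompactSpace X] [T2Space X]
    (G : Set (Set X)) (hG : G.Countable) (hGo : ∀ g ∈ G, IsOpen g)
    (hsep : ∀ x y : X, x ≠ y → ∃ a ∈ G, ∃ b ∈ G, x ∈ a ∧ y ∈ b ∧ Disjoint a b) :
    MetrizableSpace X := by
  have hle : t ≤ generateFrom G := le_generateFrom hGo
  have heq : t = generateFrom G := by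
    refine le_antisymm hle ?_
    have hT2 : @T2Space X (generateFrom G) := by
      refine @T2Space.mk X (generateFrom G) ?_
      intro x y hxy
      obtain ⟨a, ha, b, hb, hx, hy, hab⟩ := hsep x y hxy
      exact ⟨a, b, isOpen_generateFrom_of_mem ha, isOpen_generateFrom_of_mem hb, hx, hy, hab⟩
    have hcont : @Continuous X X t (generateFrom G) id := continuous_id_iff_le.2 hle
    have hclosed : @IsClosedMap X X t (generateFrom G) id :=
      @Continuous.isClosedMap X X t (generateFrom G) _ hT2 id hcont
    intro u hu
    have h1 : @IsClosed X t uᶜ := hu.isClosed_compl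
    have h2 := hclosed uᶜ h1
    rw [image_id] at h2
    have h3 := (@isOpen_compl_iff X uᶜ (generateFrom G)).2 h2
    rwa [compl_compl] at h3
  haveI : SecondCountableTopology X := ⟨G, hG, heq⟩
  infer_instance

lemma metrizable_of_H {X : Type*} [TopologicalSpace X] [T3Space X] (hpc : Pseudocompact X)
    (H : Omega1OmegaParacompact {p : X × X // p.1 ≠ p.2}) : MetrizableSpace X := by
  classical
  haveI : CompactSpace X := compact_of_H hpc H
  rcases isEmpty_or_nonempty X with hemp | ⟨⟨x0⟩⟩
  · infer_instance
  obtain ⟨V, hVo, hVd, hVc, hVr, hVl⟩ := transfer_cover H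
    {u | ∃ A B : Set X, IsOpen A ∧ IsOpen B ∧ Disjoint (closure A) (closure B) ∧ u = A ×ˢ B} (by
      rintro _ ⟨A, B, hA, hB, _, rfl⟩
      exact hA.prod hB) (by
      rintro ⟨x, y⟩ hxy
      obtain ⟨u, hau, huo, v, hbv, hvo, huv⟩ := exists_open_nhds_disjoint_closure hxy
      exact ⟨_, ⟨u, v, huo, hvo, huv, rfl⟩, hau, hbv⟩)
  have hAB : ∀ v, ∃ A B : Set X, v ∈ V → IsOpen A ∧ IsOpen B ∧
      Disjoint (closure A) (closure B) ∧ v ⊆ A ×ˢ B := by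
    intro v
    by_cases hv : v ∈ V
    · obtain ⟨_, ⟨A, B, hA, hB, hd, rfl⟩, hs⟩ := hVr v hv
      exact ⟨A, B, fun _ => ⟨hA, hB, hd, hs⟩⟩
    · exact ⟨∅, ∅, fun h => absurd h hv⟩
  choose A B hAB using hAB
  have hsl : ∀ c, {v ∈ V | ∃ y, (c, y) ∈ v}.Countable := fun c =>
    slice_all hpc hVo hVd hVc hVl A B (fun v hv => (hAB v hv).2.1)
      (fun v hv => (hAB v hv).2.2.1) (fun v hv => (hAB v hv).2.2.2) c
  have hpick : ∀ F : Finset (Set (X × X)), ∃ x : X,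
      (∃ p, ∀ v ∈ F, p ∈ B v) → ∀ v ∈ F, x ∈ B v := by
    intro F
    by_cases h : ∃ p, ∀ v ∈ F, p ∈ B v
    · exact ⟨h.choose, fun _ => h.choose_spec⟩
    · exact ⟨x0, fun h' => absurd h' h⟩
  choose pick hpick using hpick
  obtain ⟨C, hCc, hC⟩ := exists_closing (fun c => {v ∈ V | ∃ y, (c, y) ∈ v}) hsl pick
  have hdense : ∀ p, p ∈ closure C := by
    intro p
    by_contra hp
    have hK : IsCompact (closure C) := isClosed_closure.isCompact
    have hv : ∀ z, ∃ v, z ∈ closure C → v ∈ V ∧ (z, p) ∈ v := by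
      intro z
      by_cases hz : z ∈ closure C
      · obtain ⟨v, hv, h⟩ := hVc (z, p) (fun h : z = p => hp (h ▸ hz))
        exact ⟨v, fun _ => ⟨hv, h⟩⟩
      · exact ⟨∅, fun h => absurd h hz⟩
    choose w hw using hv
    have hcont : Continuous (fun x : X => (x, p)) := by fun_prop
    obtain ⟨t, ht, htc⟩ := hK.elim_nhds_subcover (fun z => (fun x => (x, p)) ⁻¹' (w z))
      fun z hz => ((hVo _ (hw z hz).1).preimage hcont).mem_nhds (hw z hz).2
    have hmem : pick (t.image w) ∈ C := by
      apply hC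
      intro v hv
      obtain ⟨z, hz, rfl⟩ := Finset.mem_image.1 hv
      obtain ⟨c, hc1, hc2⟩ := mem_closure_iff.1 (ht z hz) _
        ((hVo _ (hw z (ht z hz)).1).preimage hcont) (hw z (ht z hz)).2
      exact ⟨c, hc2, (hw z (ht z hz)).1, p, hc1⟩
    have hB : ∀ v ∈ t.image w, pick (t.image w) ∈ B v := by
      apply hpick
      refine ⟨p, fun v hv => ?_⟩
      obtain ⟨z, hz, rfl⟩ := Finset.mem_image.1 hv
      have hz' := hw z (ht z hz)
      exact ((hAB _ hz'.1).2.2.2 hz'.2).2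
    obtain ⟨z, hz, hqz⟩ := mem_iUnion₂.1 (htc (subset_closure hmem))
    have hz' := hw z (ht z hz)
    have h1 := ((hAB _ hz'.1).2.2.2 hqz).1
    have h2 := hB _ (Finset.mem_image_of_mem w hz)
    exact (hAB _ hz'.1).2.2.1.le_bot ⟨subset_closure h1, subset_closure h2⟩
  have hV' : {v ∈ V | v.Nonempty}.Countable := by
    refine (hCc.biUnion (t := fun c _ => {v ∈ V | ∃ y, (c, y) ∈ v}) fun c _ => hsl c).mono ?_
    rintro v ⟨hv, ⟨x, y⟩, hxy⟩
    obtain ⟨c, hc1, hc2⟩ := mem_closure_iff.1 (hdense x) _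
      ((hVo v hv).preimage (show Continuous (fun x : X => (x, y)) by fun_prop)) hxy
    exact mem_biUnion hc2 ⟨hv, y, hc1⟩
  refine metrizable_of_pairs (A '' {v ∈ V | v.Nonempty} ∪ B '' {v ∈ V | v.Nonempty})
    ((hV'.image A).union (hV'.image B)) ?_ ?_
  · rintro _ (⟨v, hv, rfl⟩ | ⟨v, hv, rfl⟩)
    · exact (hAB v hv.1).1
    · exact (hAB v hv.1).2.1
  · intro x y hxy
    obtain ⟨v, hv, h⟩ := hVc (x, y) hxy
    have hv' : v ∈ {v ∈ V | v.Nonempty} := ⟨hv, _, h⟩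
    exact ⟨A v, Or.inl ⟨v, hv', rfl⟩, B v, Or.inr ⟨v, hv', rfl⟩, ((hAB v hv).2.2.2 h).1,
      ((hAB v hv).2.2.2 h).2, (hAB v hv).2.2.1.mono subset_closure subset_closure⟩

lemma offLF_of_P {P Y : Type*} [PartialOrder P] [TopologicalSpace Y]
    (hcal : CalibreOmega1Omega P) (hP : PParacompact P Y) : Omega1OmegaParacompact Y := by
  classical
  intro U hU
  obtain ⟨V, hVc, hVr, c, hmono, hlf, hcV⟩ := hP U hU
  refine ⟨V, hVc, hVr, ?_⟩
  intro D hD hDc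
  have hex : ∀ d : D, ∃ p, (d : Set Y) ∈ c p := by
    intro d
    have := hD d.2
    rw [← hcV] at this
    exact mem_iUnion.1 this
  choose f hf using hex
  by_cases hr : (range f).Countable
  · have : ∃ p ∈ range f, ((Subtype.val '' (f ⁻¹' {p}) : Set (Set Y))).Infinite := by
      by_contra hcon
      push Not at hcon
      refine hDc ((hr.biUnion (t := fun p _ => (Subtype.val '' (f ⁻¹' {p}) : Set (Set Y)))
        fun p hp => ?_).mono ?_)
      · exact (not_infinite.1 (fun h => by simpa using absurd (hcon p hp) (by simpa using h))).countable
      · intro d hd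
        exact mem_biUnion (mem_range_self (⟨d, hd⟩ : D)) ⟨⟨d, hd⟩, rfl, rfl⟩
    obtain ⟨p, _, hp⟩ := this
    refine ⟨_, ?_, hp, ?_⟩
    · rintro _ ⟨d, _, rfl⟩
      exact d.2
    · intro y
      obtain ⟨N, hN, hfin⟩ := hlf p y
      refine ⟨N, hN, hfin.subset ?_⟩
      rintro _ ⟨⟨d, hd, rfl⟩, h⟩
      exact ⟨by rw [← show f d = p from hd]; exact hf d, h⟩
  · obtain ⟨T, hT, hTi, b, hb⟩ := hcal _ hr
    have hinf : (f ⁻¹' T).Infinite := hTi.preimage hT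
    refine ⟨Subtype.val '' (f ⁻¹' T), ?_, hinf.image Subtype.val_injective.injOn, ?_⟩
    · rintro _ ⟨d, _, rfl⟩
      exact d.2
    · intro y
      obtain ⟨N, hN, hfin⟩ := hlf b y
      refine ⟨N, hN, hfin.subset ?_⟩
      rintro _ ⟨⟨d, hd, rfl⟩, h⟩
      exact ⟨hmono _ _ (hb _ hd) (hf d), h⟩

lemma P_of_paracompact (P Y : Type*) [PartialOrder P] [Nonempty P] [TopologicalSpace Y]
    [ParacompactSpace Y] : PParacompact P Y := by
  intro U hU
  obtain ⟨v, hvo, hvc, hvl, hvs⟩ := precise_refinement (fun u : U => (u : Set Y))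
    (fun u => hU.1 u u.2) (by rw [← sUnion_eq_iUnion]; exact hU.2)
  refine ⟨range v, ⟨?_, ?_⟩, ?_, fun _ => range v, fun _ _ _ => le_rfl, fun _ => ?_,
    iUnion_const _⟩
  · rintro _ ⟨i, rfl⟩
    exact hvo i
  · rw [sUnion_range]
    exact hvc
  · rintro _ ⟨i, rfl⟩
    exact ⟨i, i.2, hvs i⟩
  · intro y
    obtain ⟨N, hN, hf⟩ := hvl y
    refine ⟨N, hN, (hf.image v).subset ?_⟩
    rintro _ ⟨⟨i, rfl⟩, h⟩
    exact ⟨i, h, rfl⟩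

/-- For a pseudocompact Tychonoff space `X`, the following are
equivalent: (i) `X` is metrizable; (ii) `X² ∖ Δ` is (ω₁,ω)-paracompact;
(iii) `X² ∖ Δ` is `P`-paracompact for some directed set `P` with calibre (ω₁,ω). -/
theorem statement0.{u, v} (X : Type u) [TopologicalSpace X] [T35Space X]
    (hpc : Pseudocompact X) :
    (MetrizableSpace X ↔ Omega1OmegaParacompact {p : X × X // p.1 ≠ p.2}) ∧
    (Omega1OmegaParacompact {p : X × X // p.1 ≠ p.2} ↔
      ∃ (P : Type v) (_ : PartialOrder P), DirectedPoset P ∧ CalibreOmega1Omega P ∧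
        PParacompact P {p : X × X // p.1 ≠ p.2}) := by
  have h32 : (∃ (P : Type v) (_ : PartialOrder P), DirectedPoset P ∧ CalibreOmega1Omega P ∧
        PParacompact P {p : X × X // p.1 ≠ p.2}) →
      Omega1OmegaParacompact {p : X × X // p.1 ≠ p.2} := by
    rintro ⟨P, _, _, hcal, hP⟩
    exact offLF_of_P hcal hP
  have h21 : Omega1OmegaParacompact {p : X × X // p.1 ≠ p.2} → MetrizableSpace X :=
    metrizable_of_H hpc
  have h13 : MetrizableSpace X → ∃ (P : Type v) (_ : PartialOrder P), DirectedPoset P ∧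
      CalibreOmega1Omega P ∧ PParacompact P {p : X × X // p.1 ≠ p.2} := by
    intro hm
    letI : MetricSpace X := metrizableSpaceMetric X
    refine ⟨PUnit, inferInstance, fun a b => ⟨a, le_rfl, le_rfl⟩, ?_, P_of_paracompact _ _⟩
    intro S hS
    exact absurd S.to_countable hS
  exact ⟨⟨fun h => h32 (h13 h), h21⟩, ⟨fun h => h13 (h21 h), h32⟩⟩
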